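/- arXiv:1707.00167 — 2 statements merged into one kernel-verified Lean document; each statement's English description precedes it below -/
import Mathlib

section
/- Let G be a finite graph on n ≥ 4 vertices with labels assigned by a uniform random permutation, and let R_w(t) = q(t)R₁(t) + p(t)R₂(t) with p(t) = (t−1)/(n−2), q(t) = 1−p(t). Then Var(R_w(t)) = [t(t−1)(n−t)(n−t−1)/(n(n−1)(n−2)(n−3))] · ( |G| − Σᵢ|Gᵢ|²/(n−2) + 2|G|²/((n−1)(n−2)) ). -/
open Finset
open scoped Classical

noncomputable section

/-- Label of vertex `v` under permutation `π`: a value in `{1,...,n}`. -/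
def lab {n : ℕ} (π : Equiv.Perm (Fin n)) (v : Fin n) : ℕ := (π v).val + 1

/-- Number of edges of `G` with both endpoint labels `≤ t`. -/
def R1 {n : ℕ} (G : SimpleGraph (Fin n)) (t : ℕ) (π : Equiv.Perm (Fin n)) : ℕ :=
  (G.edgeFinset.filter (fun e => ∀ v ∈ e, lab π v ≤ t)).card

/-- Number of edges of `G` with both endpoint labels `> t`. -/
def R2 {n : ℕ} (G : SimpleGraph (Fin n)) (t : ℕ) (π : Equiv.Perm (Fin n)) : ℕ :=
  (G.edgeFinset.filter (fun e => ∀ v ∈ e, t < lab π v)).card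

/-- Number of edges of `G` with one endpoint label `≤ t` and the other `> t`. -/
def R0 {n : ℕ} (G : SimpleGraph (Fin n)) (t : ℕ) (π : Equiv.Perm (Fin n)) : ℕ :=
  (G.edgeFinset.filter (fun e => (∃ v ∈ e, lab π v ≤ t) ∧ (∃ v ∈ e, t < lab π v))).card

/-- Expectation under the permutation null distribution (uniform over all `n!` permutations). -/
def Ex {n : ℕ} (f : Equiv.Perm (Fin n) → ℝ) : ℝ :=
  (∑ π : Equiv.Perm (Fin n), f π) / (Nat.factorial n)

/-- Variance under the permutation null distribution. -/
def Var {n : ℕ} (f : Equiv.Perm (Fin n) → ℝ) : ℝ := Ex (fun π => (f π - Ex f) ^ 2)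

/-- Covariance under the permutation null distribution. -/
def Cov {n : ℕ} (f g : Equiv.Perm (Fin n) → ℝ) : ℝ :=
  Ex (fun π => (f π - Ex f) * (g π - Ex g))

/-- Weighted edge count `R_w(t) = q(t) R₁(t) + p(t) R₂(t)` with `p(t) = (t-1)/(n-2)`. -/
def Rw {n : ℕ} (G : SimpleGraph (Fin n)) (t : ℕ) (π : Equiv.Perm (Fin n)) : ℝ :=
  (1 - ((t : ℝ) - 1) / ((n : ℝ) - 2)) * (R1 G t π : ℝ)
    + (((t : ℝ) - 1) / ((n : ℝ) - 2)) * (R2 G t π : ℝ)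


/-- Joint second moment of a kernel under a uniform random permutation (unnormalised). -/
def CC {n : ℕ} (K : Fin n → Fin n → ℝ) (a b c d : Fin n) : ℝ :=
  ∑ π : Equiv.Perm (Fin n), K (π a) (π b) * K (π c) (π d)

lemma CC_inv {n : ℕ} (K : Fin n → Fin n → ℝ) (s : Equiv.Perm (Fin n)) (a b c d : Fin n) :
    CC K (s a) (s b) (s c) (s d) = CC K a b c d := by
  unfold CC
  exact Fintype.sum_equiv (Equiv.mulRight s) _ _ (fun π => by simp)

lemma CC_row {n : ℕ} (K : Fin n → Fin n → ℝ) (hrow : ∀ i, ∑ j, K i j = 0) (a b c : Fin n) :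
    ∑ d, CC K a b c d = 0 := by
  unfold CC
  rw [Finset.sum_comm]
  refine Finset.sum_eq_zero fun π _ => ?_
  rw [← Finset.mul_sum, Equiv.sum_comp π (fun j => K (π c) j), hrow, mul_zero]

lemma E_pair {n : ℕ} (hn : 4 ≤ n) (K : Fin n → Fin n → ℝ) (hrow : ∀ i, ∑ j, K i j = 0)
    (hdiag : ∀ i, K i i = 0) (a b : Fin n) :
    ∑ π : Equiv.Perm (Fin n), K (π a) (π b) = 0 := by
  by_cases hab : a = b
  · subst hab; simp [hdiag]
  have h1 : ∑ d, ∑ π : Equiv.Perm (Fin n), K (π a) (π d) = 0 := by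
    rw [Finset.sum_comm]
    refine Finset.sum_eq_zero fun π _ => ?_
    rw [Equiv.sum_comp π (fun j => K (π a) j), hrow]
  have h2 : ∀ d, ∑ π : Equiv.Perm (Fin n), K (π a) (π d)
      = if d = a then 0 else ∑ π : Equiv.Perm (Fin n), K (π a) (π b) := by
    intro d
    split_ifs with h
    · subst h; simp [hdiag]
    · refine Fintype.sum_equiv (Equiv.mulRight (Equiv.swap d b)) _ _ (fun π => ?_)
      simp [Equiv.swap_apply_of_ne_of_ne (Ne.symm h) hab]
  rw [Finset.sum_congr rfl (fun d _ => h2 d)] at h1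
  simp only [Finset.sum_ite, Finset.sum_const, Finset.filter_ne', smul_zero, zero_add,
    Finset.card_erase_of_mem (Finset.mem_univ a), Finset.card_univ, Fintype.card_fin,
    nsmul_eq_mul, mul_eq_zero] at h1
  rcases h1 with h1 | h1
  · have : n - 1 = 0 := by exact_mod_cast h1
    omega
  · exact h1

lemma CC_diag_eq {n : ℕ} (K : Fin n → Fin n → ℝ) {a b c d : Fin n} (hab : a ≠ b) (hcd : c ≠ d) :
    CC K a b a b = CC K c d c d := by
  obtain ⟨s, h1, h2⟩ : ∃ s : Equiv.Perm (Fin n), s a = c ∧ s b = d := by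
    refine ⟨Equiv.swap (Equiv.swap a c b) d * Equiv.swap a c, ?_, ?_⟩
    · have h : Equiv.swap a c b ≠ c := by
        intro h
        have := (Equiv.swap a c).injective (h.trans (Equiv.swap_apply_left a c).symm)
        exact hab this.symm
      simp [Equiv.swap_apply_of_ne_of_ne h.symm hcd]
    · simp
  rw [← CC_inv K s a b a b, h1, h2]

lemma CC_two {n : ℕ} (hn : 4 ≤ n) (K : Fin n → Fin n → ℝ)
    (hdiag : ∀ i, K i i = 0) {a b : Fin n} (hab : a ≠ b) :
    (n : ℝ) * (n - 1) * CC K a b a b = n.factorial * ∑ i, ∑ j, K i j ^ 2 := by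
  have h1 : ∑ c, ∑ d, CC K c d c d = n.factorial * ∑ i, ∑ j, K i j ^ 2 := by
    have : ∀ π : Equiv.Perm (Fin n), ∑ c, ∑ d, K (π c) (π d) * K (π c) (π d)
        = ∑ i, ∑ j, K i j ^ 2 := by
      intro π
      rw [Equiv.sum_comp π (fun i => ∑ d, K i (π d) * K i (π d))]
      refine Finset.sum_congr rfl fun i _ => ?_
      rw [Equiv.sum_comp π (fun j => K i j * K i j)]
      simp [sq]
    unfold CC
    rw [Finset.sum_congr rfl (fun c _ => Finset.sum_comm), Finset.sum_comm,
      Finset.sum_congr rfl (fun π _ => this π)]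
    simp [Finset.card_univ, Fintype.card_perm]
  rw [← h1]
  have h2 : ∀ c d, CC K c d c d = if d = c then 0 else CC K a b a b := by
    intro c d
    split_ifs with h
    · subst h; simp [CC, hdiag]
    · exact CC_diag_eq K (Ne.symm h) hab
  rw [Finset.sum_congr rfl (fun c _ => Finset.sum_congr rfl (fun d _ => h2 c d))]
  simp only [Finset.sum_ite, Finset.sum_const, Finset.filter_ne', smul_zero, zero_add,
    Finset.card_erase_of_mem (Finset.mem_univ _), Finset.card_univ, Fintype.card_fin,
    nsmul_eq_mul]
  rw [Nat.cast_sub (by omega)]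
  push_cast
  ring

lemma CC_one {n : ℕ} (K : Fin n → Fin n → ℝ) (hrow : ∀ i, ∑ j, K i j = 0)
    (hdiag : ∀ i, K i i = 0) {a b c : Fin n} (hab : a ≠ b) (hac : a ≠ c) (hbc : b ≠ c) :
    ((n : ℝ) - 2) * CC K a b a c = - CC K a b a b := by
  have h := CC_row K hrow a b a
  have h2 : ∀ d, CC K a b a d = CC K a b a c
      + (if d = a then - CC K a b a c else 0)
      + (if d = b then CC K a b a b - CC K a b a c else 0) := by
    intro d
    by_cases hda : d = a
    · subst hda; simp [hab]; simp [CC, hdiag]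
    by_cases hdb : d = b
    · subst hdb; simp [hda]
    simp only [hda, hdb, if_false, add_zero]
    rw [← CC_inv K (Equiv.swap d c) a b a d]
    simp [Equiv.swap_apply_of_ne_of_ne (Ne.symm hda) hac,
      Equiv.swap_apply_of_ne_of_ne (Ne.symm hdb) hbc]
  rw [Finset.sum_congr rfl (fun d _ => h2 d)] at h
  simp [Finset.sum_add_distrib] at h
  linarith

lemma CC_zero {n : ℕ} (K : Fin n → Fin n → ℝ) (hrow : ∀ i, ∑ j, K i j = 0)
    (hdiag : ∀ i, K i i = 0) (hsym : ∀ i j, K i j = K j i) {a b c d : Fin n}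
    (hab : a ≠ b) (hac : a ≠ c) (hbc : b ≠ c) (had : a ≠ d) (hbd : b ≠ d) (hcd : c ≠ d) :
    ((n : ℝ) - 3) * CC K a b c d = - CC K a b a c - CC K b a b c := by
  have h := CC_row K hrow a b c
  have e1 : CC K a b c a = CC K a b a c := by
    unfold CC; refine Finset.sum_congr rfl fun π _ => ?_; rw [hsym (π c)]
  have e2 : CC K a b c b = CC K b a b c := by
    unfold CC; refine Finset.sum_congr rfl fun π _ => ?_; rw [hsym (π c), hsym (π a)]
  have h2 : ∀ e, CC K a b c e = CC K a b c d
      + (if e = a then CC K a b a c - CC K a b c d else 0)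
      + (if e = b then CC K b a b c - CC K a b c d else 0)
      + (if e = c then - CC K a b c d else 0) := by
    intro e
    by_cases hea : e = a
    · subst hea; simp [hab, hac, e1]
    by_cases heb : e = b
    · subst heb; simp [hea, hbc, e2]
    by_cases hec : e = c
    · subst hec; simp [hea, heb]; simp [CC, hdiag]
    simp only [hea, heb, hec, if_false, add_zero]
    rw [← CC_inv K (Equiv.swap e d) a b c e]
    simp [Equiv.swap_apply_of_ne_of_ne (Ne.symm hea) had,
      Equiv.swap_apply_of_ne_of_ne (Ne.symm heb) hbd,
      Equiv.swap_apply_of_ne_of_ne (Ne.symm hec) hcd]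
  rw [Finset.sum_congr rfl (fun d _ => h2 d)] at h
  simp [Finset.sum_add_distrib] at h
  linarith

/-- Kronecker delta. -/
def dl {n : ℕ} (a b : Fin n) : ℝ := if b = a then 1 else 0

lemma CC_formula {n : ℕ} (hn : 4 ≤ n) (K : Fin n → Fin n → ℝ) (hrow : ∀ i, ∑ j, K i j = 0)
    (hdiag : ∀ i, K i i = 0) (hsym : ∀ i j, K i j = K j i) (S : ℝ)
    (hS : (n : ℝ) * (n - 1) * S = n.factorial * ∑ i, ∑ j, K i j ^ 2) {a b c d : Fin n}
    (hab : a ≠ b) (hcd : c ≠ d) :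
    CC K a b c d = S * ((n - 1) / (n - 3)) * (2 / ((n - 1) * (n - 2))
      - 1 / (n - 2) * (dl a c + dl a d + dl b c + dl b d)
      + (dl a c * dl b d + dl a d * dl b c)) := by
  have hn' : (4 : ℝ) ≤ n := by exact_mod_cast hn
  have n0 : (n : ℝ) ≠ 0 := by linarith
  have n1 : (n : ℝ) - 1 ≠ 0 := by linarith
  have n2 : (n : ℝ) - 2 ≠ 0 := by linarith
  have n3 : (n : ℝ) - 3 ≠ 0 := by linarith
  have two : ∀ {a b : Fin n}, a ≠ b → CC K a b a b = S := by
    intro a b h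
    have := CC_two hn K hdiag h
    rw [← hS] at this
    exact mul_left_cancel₀ (mul_ne_zero n0 n1) this
  have one : ∀ {a b c : Fin n}, a ≠ b → a ≠ c → b ≠ c → CC K a b a c = - S / (n - 2) := by
    intro a b c h1 h2 h3
    have := CC_one K hrow hdiag h1 h2 h3
    rw [two h1] at this
    rw [eq_div_iff n2]; linarith
  have sw2 : ∀ a b c d, CC K a b c d = CC K a b d c := by
    intro a b c d
    unfold CC; refine Finset.sum_congr rfl fun π _ => ?_; rw [hsym (π c)]
  have sw1 : ∀ a b c d, CC K a b c d = CC K b a c d := by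
    intro a b c d
    unfold CC; refine Finset.sum_congr rfl fun π _ => ?_; rw [hsym (π a)]
  unfold dl
  by_cases hac : c = a
  · subst hac
    by_cases hbd : d = b
    · subst hbd
      rw [two hab]; simp [hab, hab.symm]; field_simp; ring
    · rw [one hab hcd (Ne.symm hbd)]; simp [hab, hab.symm, hcd, hcd.symm, hbd]; field_simp; ring
  by_cases had : d = a
  · subst had
    rw [sw2]
    by_cases hbc : c = b
    · subst hbc
      rw [two hab]; simp [hab, hab.symm]; field_simp; ring
    · rw [one hab hcd.symm (Ne.symm hbc)]; simp [hab, hab.symm, hcd, hcd.symm, hbc]; field_simp; ring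
  by_cases hbc : c = b
  · subst hbc
    rw [sw1, one hab.symm hcd (Ne.symm had)]
    simp [hab, hab.symm, hcd, hcd.symm, had]; field_simp; ring
  by_cases hbd : d = b
  · subst hbd
    rw [sw1, sw2, one hab.symm hcd.symm (Ne.symm hac)]
    simp [hab, hab.symm, hcd, hcd.symm, hac]; field_simp; ring
  have := CC_zero K hrow hdiag hsym hab (Ne.symm hac) (Ne.symm hbc) (Ne.symm had) (Ne.symm hbd) hcd
  rw [one hab (Ne.symm hac) (Ne.symm hbc), one hab.symm (Ne.symm hbc) (Ne.symm hac)] at this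
  simp [hac, had, hbc, hbd]
  have h3 : CC K a b c d = (- (-S / (n - 2)) - (-S / (n - 2))) / (n - 3) := by
    rw [eq_div_iff n3]; linarith
  rw [h3]; field_simp; ring

/-- Real adjacency indicator. -/
def AA {n : ℕ} (G : SimpleGraph (Fin n)) (u v : Fin n) : ℝ := if G.Adj u v then 1 else 0

lemma sum_edges {n : ℕ} (G : SimpleGraph (Fin n)) (F : Sym2 (Fin n) → ℝ) :
    ∑ u, ∑ v, AA G u v * F s(u, v) = 2 * ∑ e ∈ G.edgeFinset, F e := by
  have h1 : ∑ d : G.Dart, F d.edge = 2 * ∑ e ∈ G.edgeFinset, F e := by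
    rw [← Finset.sum_fiberwise_of_maps_to (s := univ) (t := G.edgeFinset)
      (g := fun d : G.Dart => d.edge) (fun d _ => by simpa using d.edge_mem), Finset.mul_sum]
    refine Finset.sum_congr rfl fun e he => ?_
    have hc := G.dart_edge_fiber_card e (by simpa using he)
    rw [Finset.sum_congr rfl (g := fun _ => F e)
      (fun d hd => by rw [(Finset.mem_filter.mp hd).2]), Finset.sum_const, nsmul_eq_mul]
    congr 1
    rw [← Nat.cast_two, ← hc]
    
  rw [← h1, ← Finset.sum_product']
  simp only [AA, ite_mul, one_mul, zero_mul]
  rw [← Finset.sum_filter]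
  symm
  refine Finset.sum_bij (fun d _ => d.toProd) ?_ ?_ ?_ ?_
  · intro d _; simpa using d.adj
  · intro d _ d' _ h; exact SimpleGraph.Dart.ext _ _ h
  · intro p hp; exact ⟨⟨p, by simpa using hp⟩, by simp, rfl⟩
  · intro d _; rfl

lemma sum_AA_deg {n : ℕ} (G : SimpleGraph (Fin n)) (u : Fin n) :
    ∑ v, AA G u v = G.degree u := by
  simp only [AA, Finset.sum_boole]
  rw [← SimpleGraph.card_neighborFinset_eq_degree, SimpleGraph.neighborFinset_eq_filter]

lemma AA_symm {n : ℕ} (G : SimpleGraph (Fin n)) (u v : Fin n) : AA G u v = AA G v u := by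
  simp [AA, G.adj_comm]

lemma sum_AA {n : ℕ} (G : SimpleGraph (Fin n)) :
    ∑ u, ∑ v, AA G u v = 2 * (G.edgeFinset.card : ℝ) := by
  simpa using sum_edges G (fun _ => 1)

lemma second_moment {n : ℕ} (hn : 4 ≤ n) (K : Fin n → Fin n → ℝ) (hrow : ∀ i, ∑ j, K i j = 0)
    (hdiag : ∀ i, K i i = 0) (hsym : ∀ i j, K i j = K j i) (S : ℝ)
    (hS : (n : ℝ) * (n - 1) * S = n.factorial * ∑ i, ∑ j, K i j ^ 2) (G : SimpleGraph (Fin n)) :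
    ∑ π : Equiv.Perm (Fin n), (∑ u, ∑ v, AA G u v * K (π u) (π v)) ^ 2
     = S * ((n - 1) / (n - 3)) * (2 / ((n - 1) * (n - 2)) * (2 * (G.edgeFinset.card : ℝ)) ^ 2
      - 1 / (n - 2) * (4 * ∑ i, (G.degree i : ℝ) ^ 2)
      + 2 * (2 * (G.edgeFinset.card : ℝ))) := by
  have h1 : ∑ π : Equiv.Perm (Fin n), (∑ u, ∑ v, AA G u v * K (π u) (π v)) ^ 2
      = ∑ a, ∑ b, ∑ c, ∑ d, AA G a b * AA G c d * CC K a b c d := by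
    simp only [sq, Finset.sum_mul, Finset.mul_sum, CC]
    rw [Finset.sum_comm]
    refine Finset.sum_congr rfl fun a _ => ?_
    rw [Finset.sum_comm]
    refine Finset.sum_congr rfl fun b _ => ?_
    rw [Finset.sum_comm]
    refine Finset.sum_congr rfl fun c _ => ?_
    rw [Finset.sum_comm]
    refine Finset.sum_congr rfl fun d _ => ?_
    refine Finset.sum_congr rfl fun π _ => ?_
    ring
  set γ : ℝ := S * ((n - 1) / (n - 3))
  set α : ℝ := 2 / ((n - 1) * (n - 2))
  set β : ℝ := 1 / ((n : ℝ) - 2)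
  have h2 : ∀ a b c d, AA G a b * AA G c d * CC K a b c d = 
      γ * (α * (AA G a b * AA G c d)
      - β * (AA G a b * (AA G c d * dl a c) + AA G a b * (AA G c d * dl a d)
        + AA G a b * (AA G c d * dl b c) + AA G a b * (AA G c d * dl b d))
      + (AA G a b * (AA G c d * dl b d * dl a c) + AA G a b * (AA G c d * dl a d * dl b c))) := by
    intro a b c d
    by_cases hab : G.Adj a b
    · by_cases hcd : G.Adj c d
      · rw [CC_formula hn K hrow hdiag hsym S hS hab.ne hcd.ne]; ring
      · simp [AA, hcd]
    · simp [AA, hab]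
  have hr : ∀ v, ∑ u, AA G u v = G.degree v := by
    intro v; rw [← sum_AA_deg]; exact Finset.sum_congr rfl fun u _ => AA_symm G u v
  have hsq : ∀ a b, AA G a b * AA G a b = AA G a b := by intro a b; simp [AA]
  have d1 : ∀ (f : Fin n → ℝ) a, ∑ d, f d * dl a d = f a := by intro f a; simp [dl]
  rw [h1]
  simp only [h2, ← Finset.mul_sum, Finset.sum_add_distrib, Finset.sum_sub_distrib]
  congr 1
  have p1 : ∑ a, ∑ b, ∑ c, ∑ d, AA G a b * AA G c d = (2 * (G.edgeFinset.card : ℝ)) ^ 2 := by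
    simp only [← Finset.mul_sum, ← Finset.sum_mul, sum_AA, sq]
  have p2 : ∑ a, ∑ b, AA G a b * ∑ c, ∑ d, AA G c d * dl a c = ∑ i, (G.degree i : ℝ) ^ 2 := by
    simp only [← Finset.sum_mul, sum_AA_deg, d1, sq]
  have p3 : ∑ a, ∑ b, AA G a b * ∑ c, ∑ d, AA G c d * dl a d = ∑ i, (G.degree i : ℝ) ^ 2 := by
    simp only [← Finset.sum_mul, sum_AA_deg, d1, sq, hr]
  have p4 : ∑ a, ∑ b, AA G a b * ∑ c, ∑ d, AA G c d * dl b c = ∑ i, (G.degree i : ℝ) ^ 2 := by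
    rw [Finset.sum_comm]
    simp only [← Finset.sum_mul, sum_AA_deg, d1, sq, hr]
  have p5 : ∑ a, ∑ b, AA G a b * ∑ c, ∑ d, AA G c d * dl b d = ∑ i, (G.degree i : ℝ) ^ 2 := by
    rw [Finset.sum_comm]
    simp only [← Finset.sum_mul, sum_AA_deg, d1, sq, hr]
  have p6 : ∑ a, ∑ b, AA G a b * ∑ c, ∑ d, AA G c d * dl b d * dl a c
      = 2 * (G.edgeFinset.card : ℝ) := by
    simp only [← Finset.sum_mul, d1, hsq, sum_AA]
  have p7 : ∑ a, ∑ b, AA G a b * ∑ c, ∑ d, AA G c d * dl a d * dl b c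
      = 2 * (G.edgeFinset.card : ℝ) := by
    have : ∀ a b, AA G a b * AA G b a = AA G a b := by
      intro a b; rw [AA_symm G b a, hsq]
    simp only [← Finset.sum_mul, d1, this, sum_AA]
  simp only [← Finset.mul_sum] at p1
  rw [p1, p2, p3, p4, p5, p6, p7]
  ring

/-- Indicator of label `≤ t`. -/
def yy {n : ℕ} (t : ℕ) (i : Fin n) : ℝ := if i.val + 1 ≤ t then 1 else 0

lemma sum_yy {n t : ℕ} (ht : t < n) : ∑ i : Fin n, yy t i = t := by
  unfold yy
  rw [Fin.sum_univ_eq_sum_range (fun i => if i + 1 ≤ t then (1 : ℝ) else 0) n, Finset.sum_boole]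
  congr 1
  have : (Finset.range n).filter (fun i => i + 1 ≤ t) = Finset.range t := by
    ext i; simp; omega
  rw [this, Finset.card_range]

lemma yy_sq {n t : ℕ} (i : Fin n) : yy t i * yy t i = yy t i := by simp [yy]

/-- The centred kernel. -/
def KK {n : ℕ} (t : ℕ) (p μ : ℝ) (i j : Fin n) : ℝ :=
  (1 - dl i j) * (yy t i * yy t j + p * (1 - yy t i - yy t j) - μ)

lemma Rw_eq {n t : ℕ} (G : SimpleGraph (Fin n)) (μ : ℝ) (π : Equiv.Perm (Fin n)) :
    Rw G t π - μ * G.edgeFinset.card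
      = (1 / 2) * ∑ u, ∑ v, AA G u v * KK t (((t : ℝ) - 1) / ((n : ℝ) - 2)) μ (π u) (π v) := by
  set p := ((t : ℝ) - 1) / ((n : ℝ) - 2) with hp
  have h := sum_edges G (fun e => (1 - p) * (if ∀ v ∈ e, lab π v ≤ t then 1 else 0)
    + p * (if ∀ v ∈ e, t < lab π v then 1 else 0) - μ)
  have h2 : ∀ u v, AA G u v * KK t p μ (π u) (π v) = AA G u v * 
     ((1 - p) * (if ∀ w ∈ s(u, v), lab π w ≤ t then 1 else 0)
    + p * (if ∀ w ∈ s(u, v), t < lab π w then 1 else 0) - μ) := by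
    intro u v
    by_cases huv : G.Adj u v
    · have : π v ≠ π u := fun h => huv.ne (π.injective h).symm
      simp only [AA, huv, if_true, one_mul, KK, dl, this, if_false, sub_zero, Sym2.mem_iff,
        forall_eq_or_imp, forall_eq, yy, lab]
      by_cases h1 : (π u).val + 1 ≤ t <;> by_cases h2 : (π v).val + 1 ≤ t <;>
        simp [h1, h2] <;> grind
    · simp [AA, huv]
  simp only [h2]
  rw [h]
  simp only [Finset.sum_add_distrib, Finset.sum_sub_distrib, ← Finset.mul_sum, Finset.sum_boole,
    Finset.sum_const, nsmul_eq_mul, Rw, R1, R2, ← hp]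
  ring

theorem variance_Rw (n t : ℕ) (hn : 4 ≤ n) (ht1 : 1 ≤ t) (ht2 : t < n)
    (G : SimpleGraph (Fin n)) :
    Var (fun π => Rw G t π) =
      (t : ℝ) * ((t : ℝ) - 1) * ((n : ℝ) - (t : ℝ)) * ((n : ℝ) - (t : ℝ) - 1) /
        ((n : ℝ) * ((n : ℝ) - 1) * ((n : ℝ) - 2) * ((n : ℝ) - 3))
      * ((G.edgeFinset.card : ℝ)
          - (∑ i : Fin n, (G.degree i : ℝ) ^ 2) / ((n : ℝ) - 2)
          + 2 * (G.edgeFinset.card : ℝ) ^ 2 / (((n : ℝ) - 1) * ((n : ℝ) - 2))) := by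
  have hn' : (4 : ℝ) ≤ n := by exact_mod_cast hn
  have n0 : (n : ℝ) ≠ 0 := by linarith
  have n1 : (n : ℝ) - 1 ≠ 0 := by linarith
  have n2 : (n : ℝ) - 2 ≠ 0 := by linarith
  have n3 : (n : ℝ) - 3 ≠ 0 := by linarith
  have hf : (n.factorial : ℝ) ≠ 0 := by exact_mod_cast n.factorial_ne_zero
  set p := ((t : ℝ) - 1) / ((n : ℝ) - 2) with hp
  set μ := ((n : ℝ) - 1 - t) * (t - 1) / ((n - 2) * (n - 1)) with hμ
  set K : Fin n → Fin n → ℝ := KK t p μ with hK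
  have hy := sum_yy ht2
  have hdiag : ∀ i, K i i = 0 := by intro i; simp [hK, KK, dl]
  have hsym : ∀ i j, K i j = K j i := by
    intro i j; simp only [hK, KK, dl, eq_comm (a := i)]; ring
  have hexp : ∀ (f : Fin n → ℝ) (i : Fin n), ∑ j, (1 - dl i j) * f j = ∑ j, f j - f i := by
    intro f i; simp [dl, sub_mul, Finset.sum_sub_distrib]
  have hrow : ∀ i, ∑ j, K i j = 0 := by
    intro i
    simp only [hK, KK]
    rw [hexp (fun j => yy t i * yy t j + p * (1 - yy t i - yy t j) - μ)]
    simp only [Finset.sum_add_distrib, Finset.sum_sub_distrib, ← Finset.mul_sum, hy,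
      Finset.sum_const, Finset.card_univ, Fintype.card_fin, nsmul_eq_mul, yy_sq]
    rw [hp, hμ]; field_simp; ring
  have hsq : ∑ i, ∑ j, K i j ^ 2 = (t : ℝ) * (t - 1) * (n - t) * (n - t - 1) / ((n - 1) * (n - 2)) := by
    have e1 : ∀ i j, K i j ^ 2 = K i j * (yy t i * yy t j + p * (1 - yy t i - yy t j)) - μ * K i j := by
      intro i j
      simp only [hK, KK, dl]
      split_ifs <;> ring
    have e2 : ∀ i j, K i j * (yy t i * yy t j + p * (1 - yy t i - yy t j))
        = (1 - dl i j) * ((1 - 2 * p + p ^ 2 - p ^ 2 - μ + 2 * p ^ 2) * (yy t i * yy t j)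
          + p * (p - μ) * 1 - p * (p - μ) * yy t i - p * (p - μ) * yy t j) := by
      intro i j
      have a1 := yy_sq (t := t) i
      have a2 := yy_sq (t := t) j
      simp only [hK, KK, mul_assoc]
      congr 1
      unfold yy
      split_ifs <;> ring
    have e3 : ∀ i, ∑ j, K i j ^ 2 = ∑ j, K i j * (yy t i * yy t j + p * (1 - yy t i - yy t j)) := by
      intro i
      simp only [e1, Finset.sum_sub_distrib, ← Finset.mul_sum, hrow, mul_zero, sub_zero]
    simp only [e3, e2]
    simp only [hexp (fun j => _ * (_ * yy t j) + _ * 1 - _ * _ - _ * yy t j)]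
    simp only [Finset.sum_add_distrib, Finset.sum_sub_distrib, ← Finset.mul_sum, hy,
      Finset.sum_const, Finset.card_univ, Fintype.card_fin, nsmul_eq_mul, yy_sq, ← Finset.sum_mul]
    rw [hp, hμ]; field_simp; ring
  have hR : ∀ π, Rw G t π - μ * G.edgeFinset.card = (1 / 2) * ∑ u, ∑ v, AA G u v * K (π u) (π v) :=
    fun π => Rw_eq G μ π
  have hE : Ex (fun π => Rw G t π) = μ * G.edgeFinset.card := by
    have h1 : ∑ π : Equiv.Perm (Fin n), (Rw G t π - μ * G.edgeFinset.card) = 0 := by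
      simp only [hR, ← Finset.mul_sum]
      rw [Finset.sum_comm]
      rw [Finset.sum_eq_zero, mul_zero]
      intro u _
      rw [Finset.sum_comm]
      refine Finset.sum_eq_zero fun v _ => ?_
      rw [← Finset.mul_sum, E_pair hn K hrow hdiag, mul_zero]
    rw [Finset.sum_sub_distrib] at h1
    simp only [Finset.sum_const, Finset.card_univ, Fintype.card_perm, Fintype.card_fin,
      nsmul_eq_mul] at h1
    unfold Ex
    rw [div_eq_iff hf]; linarith
  obtain ⟨S, hS⟩ : ∃ S : ℝ, (n : ℝ) * (n - 1) * S = n.factorial * ∑ i, ∑ j, K i j ^ 2 :=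
    ⟨n.factorial * (∑ i, ∑ j, K i j ^ 2) / (n * (n - 1)), by field_simp⟩
  have hM := second_moment hn K hrow hdiag hsym S hS G
  unfold Var
  rw [hE]
  simp only [hR, mul_pow]
  unfold Ex
  rw [← Finset.mul_sum, hM]
  rw [hsq] at hS
  have hS' : S = n.factorial * ((t : ℝ) * (t - 1) * (n - t) * (n - t - 1) / ((n - 1) * (n - 2))) / (n * (n - 1)) := by
    rw [eq_div_iff (mul_ne_zero n0 n1)]; linarith
  rw [hS']
  field_simp
  ring
end
end

section
/- The limiting Gaussian process Z*_w has covariance function ρ*_w(u,v) = Cov(Z*_w(u), Z*_w(v)) = [(u∧v)(1−(u∨v))] / [(u∨v)(1−(u∧v))] for 0 < u, v < 1, where u∧v = min(u,v) and u∨v = max(u,v). Equivalently: for 0 < u ≤ v < 1, the limit as n → ∞ of Cov(Z_w([nu]), Z_w([nv])) equals u(1−v)/(v(1−u)). -/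
open Finset
open scoped Classical

noncomputable section

/-- Standardized weighted edge-count statistic. -/
def Zw {n : ℕ} (G : SimpleGraph (Fin n)) (t : ℕ) (π : Equiv.Perm (Fin n)) : ℝ :=
  (Rw G t π - Ex (fun σ => Rw G t σ)) / Real.sqrt (Var (fun σ => Rw G t σ))


/-- Symmetric kernel, zero on the diagonal, all row sums zero. -/
structure GoodK {n : ℕ} (H : Fin n → Fin n → ℝ) : Prop where
  symm : ∀ a b, H a b = H b a
  diag : ∀ a, H a a = 0
  row : ∀ a, ∑ b, H a b = 0

/-- Permutation sum of a product. -/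
def BB {n : ℕ} (H K : Fin n → Fin n → ℝ) (i j k l : Fin n) : ℝ :=
  ∑ π : Equiv.Perm (Fin n), H (π i) (π j) * K (π k) (π l)

lemma BB_inv {n : ℕ} (H K : Fin n → Fin n → ℝ) (σ : Equiv.Perm (Fin n)) (i j k l : Fin n) :
    BB H K (σ i) (σ j) (σ k) (σ l) = BB H K i j k l := by
  unfold BB
  exact Equiv.sum_comp (Equiv.mulRight σ)
    (fun π : Equiv.Perm (Fin n) => H (π i) (π j) * K (π k) (π l))

lemma BB_row {n : ℕ} (H K : Fin n → Fin n → ℝ) (hK : GoodK K) (i j k : Fin n) :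
    ∑ l, BB H K i j k l = 0 := by
  unfold BB
  rw [Finset.sum_comm]
  apply Finset.sum_eq_zero
  intro π _
  rw [← Finset.mul_sum, Equiv.sum_comp π (fun b => K (π k) b), hK.row, mul_zero]

lemma BB_symm1 {n : ℕ} (H K : Fin n → Fin n → ℝ) (hH : GoodK H) (i j k l : Fin n) :
    BB H K i j k l = BB H K j i k l := by
  unfold BB
  exact Finset.sum_congr rfl fun π _ => by rw [hH.symm]

lemma BB_symm2 {n : ℕ} (H K : Fin n → Fin n → ℝ) (hK : GoodK K) (i j k l : Fin n) :
    BB H K i j k l = BB H K i j l k := by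
  unfold BB
  exact Finset.sum_congr rfl fun π _ => by rw [hK.symm (π k)]

lemma exists_perm {n : ℕ} {i j i' j' : Fin n} (h : i ≠ j) (h' : i' ≠ j') :
    ∃ σ : Equiv.Perm (Fin n), σ i' = i ∧ σ j' = j := by
  refine ⟨Equiv.swap (Equiv.swap i' i j') j * Equiv.swap i' i, ?_, ?_⟩
  · rw [Equiv.Perm.mul_apply, Equiv.swap_apply_left]
    apply Equiv.swap_apply_of_ne_of_ne _ h
    intro hh
    have := congrArg (Equiv.swap i' i) hh
    rw [Equiv.swap_apply_right, Equiv.swap_apply_self] at this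
    exact h' this
  · rw [Equiv.Perm.mul_apply, Equiv.swap_apply_left]

lemma BB_same {n : ℕ} (hn : 4 ≤ n) (H K : Fin n → Fin n → ℝ) (hH : GoodK H)
    (i j : Fin n) (hij : i ≠ j) :
    BB H K i j i j = (n.factorial / (n * (n - 1) : ℝ)) * ∑ a, ∑ b, H a b * K a b := by
  have h1 : ∑ i', ∑ j', BB H K i' j' i' j' = n.factorial * ∑ a, ∑ b, H a b * K a b := by
    have : ∑ i', ∑ j', BB H K i' j' i' j' =
        ∑ π : Equiv.Perm (Fin n), ∑ i', ∑ j', H (π i') (π j') * K (π i') (π j') := by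
      unfold BB
      rw [Finset.sum_comm (s := (univ : Finset (Equiv.Perm (Fin n))))]
      refine Finset.sum_congr rfl fun a _ => ?_
      rw [Finset.sum_comm]
    rw [this]
    have h2 : ∀ π : Equiv.Perm (Fin n), ∑ i', ∑ j', H (π i') (π j') * K (π i') (π j') =
        ∑ a, ∑ b, H a b * K a b := by
      intro π
      rw [← Equiv.sum_comp π (fun a => ∑ b, H a b * K a b)]
      refine Finset.sum_congr rfl fun a _ => ?_
      exact Equiv.sum_comp π (fun b => H (π a) b * K (π a) b)
    rw [Finset.sum_congr rfl fun π _ => h2 π]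
    simp [Fintype.card_perm]
  have h3 : ∑ i', ∑ j', BB H K i' j' i' j' = (n * (n - 1) : ℝ) * BB H K i j i j := by
    have h4 : ∀ i', ∑ j', BB H K i' j' i' j' = (n - 1 : ℝ) * BB H K i j i j := by
      intro i'
      have h5 : ∀ j', BB H K i' j' i' j' =
          BB H K i j i j - if i' = j' then BB H K i j i j else 0 := by
        intro j'
        split_ifs with h
        · subst h
          simp [BB, hH.diag]
        · obtain ⟨σ, rfl, rfl⟩ := exists_perm hij h
          rw [BB_inv, sub_zero]
      rw [Finset.sum_congr rfl fun j' _ => h5 j', Finset.sum_sub_distrib]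
      simp; ring
    rw [Finset.sum_congr rfl fun j' _ => h4 j']
    simp; ring
  have hn' : (4 : ℝ) ≤ n := by exact_mod_cast hn
  have : (n : ℝ) - 1 ≠ 0 := by linarith
  have : (n : ℝ) ≠ 0 := by linarith
  rw [h3] at h1
  field_simp
  linarith

lemma BB_one {n : ℕ} (hn : 4 ≤ n) (H K : Fin n → Fin n → ℝ) (hK : GoodK K)
    (i j l : Fin n) (hij : i ≠ j) (hli : l ≠ i) (hlj : l ≠ j) :
    BB H K i j i l = - BB H K i j i j / (n - 2 : ℝ) := by
  have h := BB_row H K hK i j i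
  have h5 : ∀ l', BB H K i j i l' =
      BB H K i j i l + (if l' = i then - BB H K i j i l else 0)
        + (if l' = j then BB H K i j i j - BB H K i j i l else 0) := by
    intro l'
    by_cases h1 : l' = i
    · subst h1
      simp [hij, BB, hK.diag]
    · by_cases h2 : l' = j
      · subst h2; simp [h1]
      · simp only [h1, h2, if_false, add_zero]
        have := BB_inv H K (Equiv.swap l l') i j i l
        rw [Equiv.swap_apply_left, Equiv.swap_apply_of_ne_of_ne hli.symm (Ne.symm h1),
          Equiv.swap_apply_of_ne_of_ne hlj.symm (Ne.symm h2)] at this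
        exact this
  rw [Finset.sum_congr rfl fun l' _ => h5 l', Finset.sum_add_distrib, Finset.sum_add_distrib] at h
  simp at h
  have hn' : (4 : ℝ) ≤ n := by exact_mod_cast hn
  have : (n : ℝ) - 2 ≠ 0 := by linarith
  field_simp
  linarith

lemma BB_two {n : ℕ} (hn : 4 ≤ n) (H K : Fin n → Fin n → ℝ) (hK : GoodK K)
    (i j k l : Fin n) (hij : i ≠ j) (hli : l ≠ i) (hlj : l ≠ j)
    (hki : k ≠ i) (hkj : k ≠ j) (hkl : k ≠ l) :
    BB H K i j k l = - (BB H K i j i k + BB H K i j j k) / (n - 3 : ℝ) := by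
  have h := BB_row H K hK i j k
  have h5 : ∀ l', BB H K i j k l' =
      BB H K i j k l + (if l' = i then BB H K i j k i - BB H K i j k l else 0)
        + (if l' = j then BB H K i j k j - BB H K i j k l else 0)
        + (if l' = k then - BB H K i j k l else 0) := by
    intro l'
    by_cases h1 : l' = i
    · subst h1
      simp [hij, hki.symm]
    · by_cases h2 : l' = j
      · subst h2; simp [h1, hkj.symm]
      · by_cases h3 : l' = k
        · subst h3; simp [h1, h2, BB, hK.diag]
        simp only [h1, h2, h3, if_false, add_zero]
        have := BB_inv H K (Equiv.swap l l') i j k l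
        rw [Equiv.swap_apply_left, Equiv.swap_apply_of_ne_of_ne hli.symm (Ne.symm h1),
          Equiv.swap_apply_of_ne_of_ne hlj.symm (Ne.symm h2),
          Equiv.swap_apply_of_ne_of_ne hkl (Ne.symm h3)] at this
        exact this
  rw [Finset.sum_congr rfl fun l' _ => h5 l', Finset.sum_add_distrib, Finset.sum_add_distrib,
    Finset.sum_add_distrib] at h
  simp at h
  rw [BB_symm2 H K hK i j k i, BB_symm2 H K hK i j k j] at h
  have hn' : (4 : ℝ) ≤ n := by exact_mod_cast hn
  have : (n : ℝ) - 3 ≠ 0 := by linarith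
  field_simp
  linarith

lemma BB_const {n : ℕ} (hn : 4 ≤ n) (i j k l : Fin n) :
    ∃ c : ℝ, ∀ H K : Fin n → Fin n → ℝ, GoodK H → GoodK K →
      BB H K i j k l = c * ∑ a, ∑ b, H a b * K a b := by
  by_cases hij : i = j
  · exact ⟨0, fun H K hH hK => by subst hij; simp [BB, hH.diag]⟩
  by_cases hkl : k = l
  · exact ⟨0, fun H K hH hK => by subst hkl; simp [BB, hK.diag]⟩
  -- pairs meeting in the first vertex
  have key : ∀ i j l : Fin n, i ≠ j → i ≠ l → ∃ c : ℝ, ∀ H K : Fin n → Fin n → ℝ,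
      GoodK H → GoodK K → BB H K i j i l = c * ∑ a, ∑ b, H a b * K a b := by
    intro i j l hij hil
    by_cases hjl : l = j
    · subst hjl
      exact ⟨_, fun H K hH hK => BB_same hn H K hH i l hij⟩
    · refine ⟨- (n.factorial / (n * (n - 1) : ℝ)) / (n - 2 : ℝ), fun H K hH hK => ?_⟩
      rw [BB_one hn H K hK i j l hij (Ne.symm hil) hjl, BB_same hn H K hH i j hij]
      ring
  by_cases hki : k = i
  · subst hki; exact key k j l hij hkl
  by_cases hkj : k = j
  · subst hkj
    obtain ⟨c, hc⟩ := key k i l (Ne.symm hij) hkl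
    exact ⟨c, fun H K hH hK => by rw [BB_symm1 H K hH]; exact hc H K hH hK⟩
  by_cases hli : l = i
  · subst hli
    obtain ⟨c, hc⟩ := key l j k hij (Ne.symm hkl)
    exact ⟨c, fun H K hH hK => by rw [BB_symm2 H K hK]; exact hc H K hH hK⟩
  by_cases hlj : l = j
  · subst hlj
    obtain ⟨c, hc⟩ := key l i k (Ne.symm hij) (Ne.symm hkl)
    exact ⟨c, fun H K hH hK => by
      rw [BB_symm2 H K hK, BB_symm1 H K hH]; exact hc H K hH hK⟩
  obtain ⟨c, hc⟩ := key i j k hij (Ne.symm hki)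
  obtain ⟨d, hd⟩ := key j i k (Ne.symm hij) (Ne.symm hkj)
  refine ⟨-(c + d) / (n - 3 : ℝ), fun H K hH hK => ?_⟩
  rw [BB_two hn H K hK i j k l hij hli hlj hki hkj hkl, hc H K hH hK, BB_symm1 H K hH i j j k,
    hd H K hH hK]
  ring

/-- Graph sum of a kernel over ordered adjacent pairs. -/
def QQ {n : ℕ} (G : SimpleGraph (Fin n)) (H : Fin n → Fin n → ℝ) (π : Equiv.Perm (Fin n)) : ℝ :=
  ∑ i, ∑ j, (if G.Adj i j then (1 : ℝ) else 0) * H (π i) (π j)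

lemma QQ_prod {n : ℕ} (hn : 4 ≤ n) (G : SimpleGraph (Fin n)) :
    ∃ c : ℝ, ∀ H K : Fin n → Fin n → ℝ, GoodK H → GoodK K →
      ∑ π, QQ G H π * QQ G K π = c * ∑ a, ∑ b, H a b * K a b := by
  choose c hc using BB_const hn
  refine ⟨∑ i, ∑ j, ∑ k, ∑ l, (if G.Adj i j then (1 : ℝ) else 0) *
    (if G.Adj k l then (1 : ℝ) else 0) * c i j k l, fun H K hH hK => ?_⟩
  have h1 : ∀ π, QQ G H π * QQ G K π = ∑ i, ∑ j, ∑ k, ∑ l, (if G.Adj i j then (1 : ℝ) else 0) *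
    (if G.Adj k l then (1 : ℝ) else 0) * (H (π i) (π j) * K (π k) (π l)) := by
    intro π
    unfold QQ
    simp_rw [Finset.sum_mul, Finset.mul_sum]
    refine Finset.sum_congr rfl fun i _ => Finset.sum_congr rfl fun j _ =>
      Finset.sum_congr rfl fun k _ => Finset.sum_congr rfl fun l _ => ?_
    ring
  rw [Finset.sum_congr rfl fun π _ => h1 π, Finset.sum_comm, Finset.sum_mul]
  refine Finset.sum_congr rfl fun i _ => ?_
  rw [Finset.sum_comm, Finset.sum_mul]
  refine Finset.sum_congr rfl fun j _ => ?_
  rw [Finset.sum_comm, Finset.sum_mul]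
  refine Finset.sum_congr rfl fun k _ => ?_
  rw [Finset.sum_comm, Finset.sum_mul]
  refine Finset.sum_congr rfl fun l _ => ?_
  rw [← Finset.mul_sum, mul_assoc _ (c i j k l), ← hc i j k l H K hH hK]
  rfl

lemma QQ_mean {n : ℕ} (hn : 4 ≤ n) (G : SimpleGraph (Fin n)) (H : Fin n → Fin n → ℝ)
    (hH : GoodK H) : ∑ π, QQ G H π = 0 := by
  unfold QQ
  rw [Finset.sum_comm]
  refine Finset.sum_eq_zero fun i _ => ?_
  rw [Finset.sum_comm]
  refine Finset.sum_eq_zero fun j _ => ?_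
  rw [← Finset.mul_sum]
  by_cases hij : i = j
  · subst hij; simp
  apply mul_eq_zero_of_right
  have hsum : ∑ j', ∑ π : Equiv.Perm (Fin n), H (π i) (π j') = 0 := by
    rw [Finset.sum_comm]
    refine Finset.sum_eq_zero fun π _ => ?_
    rw [Equiv.sum_comp π (fun b => H (π i) b), hH.row]
  have h5 : ∀ j', ∑ π : Equiv.Perm (Fin n), H (π i) (π j') =
      ∑ π : Equiv.Perm (Fin n), H (π i) (π j) -
      (if i = j' then ∑ π : Equiv.Perm (Fin n), H (π i) (π j) else 0) := by
    intro j'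
    split_ifs with h
    · subst h; simp [hH.diag]
    · obtain ⟨σ, h1, h2⟩ := exists_perm hij h
      have e1 : σ⁻¹ i = i := by rw [Equiv.Perm.inv_eq_iff_eq]; exact h1.symm
      have e2 : σ⁻¹ j = j' := by rw [Equiv.Perm.inv_eq_iff_eq]; exact h2.symm
      have := Equiv.sum_comp (Equiv.mulRight σ⁻¹)
        (fun π : Equiv.Perm (Fin n) => H (π i) (π j))
      rw [sub_zero, ← this]
      refine Finset.sum_congr rfl fun π _ => ?_
      simp [Equiv.coe_mulRight, Equiv.Perm.mul_apply, e1, e2]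
  rw [Finset.sum_congr rfl fun j' _ => h5 j', Finset.sum_sub_distrib] at hsum
  simp at hsum
  have hn' : (4 : ℝ) ≤ n := by exact_mod_cast hn
  have h6 : ((n : ℝ) - 1) * ∑ π : Equiv.Perm (Fin n), H (π i) (π j) = 0 := by linarith
  rcases mul_eq_zero.mp h6 with h | h
  · linarith
  · exact h

/-- Indicator of label at most `t`. -/
def xx {n : ℕ} (t : ℕ) (a : Fin n) : ℝ := if a.val + 1 ≤ t then 1 else 0

lemma xx_sum {n : ℕ} (t : ℕ) (ht : t ≤ n) : ∑ a : Fin n, xx t a = t := by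
  unfold xx
  rw [Fin.sum_univ_eq_sum_range (fun a => if a + 1 ≤ t then (1 : ℝ) else 0) n, Finset.sum_boole]
  have : (Finset.range n).filter (fun a => a + 1 ≤ t) = Finset.range t := by
    ext a; simp; omega
  rw [this, Finset.card_range]

lemma xx_sq {n : ℕ} (t : ℕ) (a : Fin n) : xx t a * xx t a = xx t a := by
  unfold xx; split_ifs <;> simp

lemma xx_mul {n : ℕ} (s t : ℕ) (h : s ≤ t) (a : Fin n) : xx t a * xx s a = xx s a := by
  unfold xx; split_ifs <;> first | omega | simp

/-- The weight `p(t)`. -/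
def pp (n t : ℕ) : ℝ := ((t : ℝ) - 1) / ((n : ℝ) - 2)

/-- Centred kernel. -/
def HH {n : ℕ} (t : ℕ) (a b : Fin n) : ℝ :=
  if a = b then 0 else xx t a * xx t b - pp n t * (xx t a + xx t b) + pp n t * t / ((n : ℝ) - 1)

lemma HH_good {n : ℕ} (hn : 4 ≤ n) (t : ℕ) (ht : t ≤ n) : GoodK (HH (n := n) t) where
  symm a b := by
    unfold HH
    by_cases h : a = b
    · simp [h]
    · simp only [h, Ne.symm h, if_false]; ring
  diag a := by simp [HH]
  row a := by
    have h : ∀ b, HH t a b = (xx t a * xx t b - pp n t * (xx t a + xx t b)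
        + pp n t * t / ((n : ℝ) - 1)) - if a = b then (xx t a * xx t a - pp n t * (xx t a + xx t a)
        + pp n t * t / ((n : ℝ) - 1)) else 0 := by
      intro b
      unfold HH
      split_ifs with h
      · subst h; ring
      · ring
    rw [Finset.sum_congr rfl fun b _ => h b]
    simp only [Finset.sum_sub_distrib, Finset.sum_add_distrib, ← Finset.mul_sum, xx_sum t ht,
      Finset.sum_ite_eq, xx_sq]
    simp
    have hn' : (4 : ℝ) ≤ n := by exact_mod_cast hn
    have h1 : (n : ℝ) - 1 ≠ 0 := by linarith
    have h2 : (n : ℝ) - 2 ≠ 0 := by linarith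
    unfold pp
    field_simp
    ring

/-- Kernel inner product. -/
def SS (n s t : ℕ) : ℝ := ∑ a : Fin n, ∑ b : Fin n, HH s a b * HH t a b

lemma SS_eq {n : ℕ} (hn : 4 ≤ n) (s t : ℕ) (hst : s ≤ t) (ht : t ≤ n) :
    SS n s t = s * (s - 1) * ((n - t) * (n - t - 1)) / ((n - 1) * (n - 2)) := by
  have hg := HH_good hn t ht
  have hs : s ≤ n := hst.trans ht
  have hcol : ∀ b, ∑ a, HH (n := n) t a b = 0 := fun b => by
    rw [← hg.row b]; exact Finset.sum_congr rfl fun a _ => hg.symm a b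
  have h1 : ∀ a b : Fin n, HH s a b * HH t a b =
      (xx s a * xx s b - if a = b then xx s a else 0) *
        (1 - 2 * pp n t + pp n t * t / ((n : ℝ) - 1))
      - pp n s * xx s a * HH t a b - pp n s * (xx s b * HH t a b)
      + pp n s * s / ((n : ℝ) - 1) * HH t a b := by
    intro a b
    by_cases h : a = b
    · subst h; simp [hg.diag, xx_sq]
    · have e1 := xx_mul s t hst a
      have e2 := xx_mul s t hst b
      have key : xx s a * xx s b * HH t a b =
          xx s a * xx s b * (1 - 2 * pp n t + pp n t * t / ((n : ℝ) - 1)) := by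
        simp only [HH, h, if_false]
        linear_combination (xx s b * xx t b - pp n t * xx s b) * e1
          + (xx s a - pp n t * xx s a) * e2
      have e3 : HH s a b = xx s a * xx s b - pp n s * (xx s a + xx s b)
          + pp n s * s / ((n : ℝ) - 1) := by simp only [HH, h, if_false]
      rw [e3]
      simp only [h, if_false]
      linear_combination key
  unfold SS
  simp only [h1, Finset.sum_sub_distrib, Finset.sum_add_distrib, ← Finset.mul_sum,
    ← Finset.sum_mul, hg.row]
  rw [Finset.sum_comm (f := fun a b => xx s b * HH t a b)]
  simp only [← Finset.mul_sum, hcol, xx_sum s hs, Finset.sum_ite_eq]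
  simp [xx_sum s hs]
  have hn' : (4 : ℝ) ≤ n := by exact_mod_cast hn
  have h1 : (n : ℝ) - 1 ≠ 0 := by linarith
  have h2 : (n : ℝ) - 2 ≠ 0 := by linarith
  unfold pp
  field_simp
  ring

/-- Edge counts as sums over ordered pairs. -/
lemma edge_count {n : ℕ} (G : SimpleGraph (Fin n)) (P : Fin n → Prop) :
    ((G.edgeFinset.filter (fun e => ∀ v ∈ e, P v)).card : ℝ) =
      (1 / 2) * ∑ i, ∑ j, (if G.Adj i j then (1 : ℝ) else 0) *
        ((if P i then 1 else 0) * (if P j then 1 else 0)) := by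
  let G' : SimpleGraph (Fin n) :=
    { Adj := fun i j => G.Adj i j ∧ P i ∧ P j
      symm := ⟨fun i j h => ⟨h.1.symm, h.2.2, h.2.1⟩⟩
      loopless := ⟨fun i h => G.loopless.irrefl i h.1⟩ }
  have h1 : G.edgeFinset.filter (fun e => ∀ v ∈ e, P v) = G'.edgeFinset := by
    ext e
    induction e using Sym2.ind with
    | _ a b =>
      simp [G', SimpleGraph.mem_edgeFinset]
  have h2 := G'.sum_degrees_eq_twice_card_edges
  rw [h1]
  have h3 : ∀ i, (G'.degree i : ℝ) = ∑ j, (if G.Adj i j then (1 : ℝ) else 0) *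
        ((if P i then 1 else 0) * (if P j then 1 else 0)) := by
    intro i
    rw [← SimpleGraph.card_neighborFinset_eq_degree, SimpleGraph.neighborFinset_eq_filter,
      ← Finset.sum_boole]
    refine Finset.sum_congr rfl fun j _ => ?_
    by_cases a1 : G.Adj i j <;> by_cases a2 : P i <;> by_cases a3 : P j <;> simp [G', a1, a2, a3]
  have h4 : ((∑ i, G'.degree i : ℕ) : ℝ) = 2 * (G'.edgeFinset.card : ℝ) := by
    rw [h2]; push_cast; rfl
  push_cast at h4
  rw [Finset.sum_congr rfl fun i _ => h3 i] at h4
  linarith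

lemma Rw_eq_s11 {n : ℕ} (G : SimpleGraph (Fin n)) (t : ℕ) :
    ∃ C : ℝ, ∀ π, Rw G t π = (1 / 2) * QQ G (HH t) π + C := by
  refine ⟨∑ i, ∑ j, (1 / 2) * (if G.Adj i j then (1 : ℝ) else 0) *
    (pp n t - pp n t * t / ((n : ℝ) - 1)), fun π => ?_⟩
  unfold Rw R1 R2
  have c1 : ((G.edgeFinset.filter (fun e => ∀ v ∈ e, lab π v ≤ t)).card : ℝ) =
      (1 / 2) * ∑ i, ∑ j, (if G.Adj i j then (1 : ℝ) else 0) *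
        ((if lab π i ≤ t then 1 else 0) * (if lab π j ≤ t then 1 else 0)) := by
    convert edge_count G (fun v => lab π v ≤ t)
  have c2 : ((G.edgeFinset.filter (fun e => ∀ v ∈ e, t < lab π v)).card : ℝ) =
      (1 / 2) * ∑ i, ∑ j, (if G.Adj i j then (1 : ℝ) else 0) *
        ((if t < lab π i then 1 else 0) * (if t < lab π j then 1 else 0)) := by
    convert edge_count G (fun v => t < lab π v)
  rw [c1, c2]
  unfold QQ
  simp_rw [Finset.mul_sum, ← Finset.sum_add_distrib]
  refine Finset.sum_congr rfl fun i _ => Finset.sum_congr rfl fun j _ => ?_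
  by_cases h : G.Adj i j
  · have hne : π i ≠ π j := fun h' => h.ne (π.injective h')
    have e1 : ∀ v, (if lab π v ≤ t then (1 : ℝ) else 0) = xx t (π v) := fun v => rfl
    have e2 : ∀ v, (if t < lab π v then (1 : ℝ) else 0) = 1 - xx t (π v) := fun v => by
      rw [← e1]; split_ifs <;> first | omega | simp
    simp only [h, if_true, HH, hne, if_false, e1, e2]
    change _ * (_ * _) + _ = _
    rw [show ((t : ℝ) - 1) / ((n : ℝ) - 2) = pp n t from rfl]
    ring
  · simp [h]

lemma Rw_centred {n : ℕ} (hn : 4 ≤ n) (G : SimpleGraph (Fin n)) (t : ℕ) (ht : t ≤ n) (π) :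
    Rw G t π - Ex (fun σ => Rw G t σ) = (1 / 2) * QQ G (HH t) π := by
  obtain ⟨C, hC⟩ := Rw_eq_s11 G t
  have : Ex (fun σ => Rw G t σ) = C := by
    unfold Ex
    simp_rw [hC]
    rw [Finset.sum_add_distrib, ← Finset.mul_sum, QQ_mean hn G _ (HH_good hn t ht)]
    have : (n.factorial : ℝ) ≠ 0 := by exact_mod_cast n.factorial_ne_zero
    simp [Fintype.card_perm]
    field_simp
  rw [this, hC]; ring

lemma cov_formula {n : ℕ} (hn : 4 ≤ n) (G : SimpleGraph (Fin n)) :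
    ∃ c : ℝ, ∀ s t, s ≤ n → t ≤ n →
      Ex (fun π => (Rw G s π - Ex (fun σ => Rw G s σ)) * (Rw G t π - Ex (fun σ => Rw G t σ)))
        = c * SS n s t := by
  obtain ⟨c, hc⟩ := QQ_prod hn G
  refine ⟨c / 4 / n.factorial, fun s t hs ht => ?_⟩
  have h := hc _ _ (HH_good hn s hs) (HH_good hn t ht)
  unfold Ex SS
  have h2 : ∀ π, (Rw G s π - Ex (fun σ => Rw G s σ)) * (Rw G t π - Ex (fun σ => Rw G t σ))
      = (1 / 4) * (QQ G (HH s) π * QQ G (HH t) π) := by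
    intro π
    rw [Rw_centred hn G s hs, Rw_centred hn G t ht]; ring
  unfold Ex at h2
  rw [Finset.sum_congr rfl fun π _ => h2 π, ← Finset.mul_sum, h]
  ring

lemma cov_Z {n : ℕ} (hn : 4 ≤ n) (G : SimpleGraph (Fin n)) (s t : ℕ) (hst : s ≤ t) (ht : t ≤ n)
    (h1 : 0 < Var (fun π => Rw G s π)) (h2 : 0 < Var (fun π => Rw G t π)) :
    Cov (fun π => Zw G s π) (fun π => Zw G t π) =
      SS n s t / (Real.sqrt (SS n s s) * Real.sqrt (SS n t t)) := by
  obtain ⟨c, hc⟩ := cov_formula hn G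
  have hs := hst.trans ht
  have v : ∀ r, r ≤ n → Var (fun π => Rw G r π) = c * SS n r r := by
    intro r hr
    rw [← hc r r hr hr]
    unfold Var
    simp_rw [sq]
  have hnn : 0 ≤ SS n s s :=
    Finset.sum_nonneg fun a _ => Finset.sum_nonneg fun b _ => mul_self_nonneg _
  have hcpos : 0 < c := by
    rw [v s hs] at h1
    exact pos_of_mul_pos_left h1 hnn
  have hz : ∀ r, r ≤ n → Ex (fun π => Zw G r π) = 0 := by
    intro r hr
    unfold Ex Zw
    rw [← Finset.sum_div, Finset.sum_congr rfl fun π _ => Rw_centred hn G r hr π,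
      ← Finset.mul_sum, QQ_mean hn G _ (HH_good hn r hr)]
    simp
  unfold Cov
  rw [hz s hs, hz t ht]
  have e : Ex (fun π => (Zw G s π - 0) * (Zw G t π - 0)) =
      Ex (fun π => (Rw G s π - Ex (fun σ => Rw G s σ)) * (Rw G t π - Ex (fun σ => Rw G t σ)))
        / (Real.sqrt (Var (fun σ => Rw G s σ)) * Real.sqrt (Var (fun σ => Rw G t σ))) := by
    have hd : ∀ (f : Equiv.Perm (Fin n) → ℝ) (d : ℝ), Ex f / d = Ex (fun π => f π / d) := by
      intro f d
      unfold Ex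
      rw [div_right_comm, Finset.sum_div]
    rw [hd]
    congr 1
    funext π
    rw [sub_zero, sub_zero, ← div_mul_div_comm]
    rfl
  rw [e, hc s t hs ht, v s hs, v t ht, Real.sqrt_mul hcpos.le, Real.sqrt_mul hcpos.le]
  have hsq := Real.mul_self_sqrt hcpos.le
  rw [show √c * √(SS n s s) * (√c * √(SS n t t)) = (√c * √c) * (√(SS n s s) * √(SS n t t)) by ring,
    hsq, mul_div_mul_left _ _ hcpos.ne']

theorem limiting_covariance_Zw (u v : ℝ) (hu : 0 < u) (huv : u ≤ v) (hv : v < 1)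
    (G : ∀ n : ℕ, SimpleGraph (Fin n))
    (hVar : ∀ᶠ n : ℕ in Filter.atTop,
        0 < Var (fun π => Rw (G n) ⌊(n : ℝ) * u⌋₊ π) ∧
        0 < Var (fun π => Rw (G n) ⌊(n : ℝ) * v⌋₊ π)) :
    Filter.Tendsto
      (fun n : ℕ =>
        Cov (fun π => Zw (G n) ⌊(n : ℝ) * u⌋₊ π) (fun π => Zw (G n) ⌊(n : ℝ) * v⌋₊ π))
      Filter.atTop (nhds (u * (1 - v) / (v * (1 - u)))) := by
  have hv0 : 0 < v := hu.trans_le huv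
  have hu1 : u < 1 := huv.trans_lt hv
  have hlim : ∀ w : ℝ, 0 < w →
      Filter.Tendsto (fun n : ℕ => (⌊(n : ℝ) * w⌋₊ : ℝ) / n) Filter.atTop (nhds w) := by
    intro w hw
    have := (tendsto_nat_floor_mul_div_atTop hw.le).comp
      (tendsto_natCast_atTop_atTop (R := ℝ))
    refine this.congr fun n => ?_
    simp [mul_comm]
  have hinv : Filter.Tendsto (fun n : ℕ => (1 : ℝ) / n) Filter.atTop (nhds 0) :=
    tendsto_one_div_atTop_nhds_zero_nat
  -- normalised covariances
  have hSlim : ∀ w z : ℝ, 0 < w → w ≤ z → z < 1 →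
      Filter.Tendsto (fun n : ℕ => SS n ⌊(n : ℝ) * w⌋₊ ⌊(n : ℝ) * z⌋₊ / (n : ℝ) ^ 2)
        Filter.atTop (nhds (w ^ 2 * (1 - z) ^ 2)) := by
    intro w z hw hwz hz
    have a := hlim w hw
    have b := hlim z (hw.trans_le hwz)
    have hT : Filter.Tendsto (fun n : ℕ => ((⌊(n : ℝ) * w⌋₊ : ℝ) / n) *
        ((⌊(n : ℝ) * w⌋₊ : ℝ) / n - 1 / n) * ((1 - (⌊(n : ℝ) * z⌋₊ : ℝ) / n) *
        (1 - (⌊(n : ℝ) * z⌋₊ : ℝ) / n - 1 / n)) / ((1 - 1 / n) * (1 - 2 * (1 / n))))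
        Filter.atTop (nhds (w * (w - 0) * ((1 - z) * (1 - z - 0)) / ((1 - 0) * (1 - 2 * 0)))) := by
      refine Filter.Tendsto.div ?_ ?_ (by norm_num)
      · exact (a.mul (a.sub hinv)).mul ((b.const_sub 1).mul ((b.const_sub 1).sub hinv))
      · exact (hinv.const_sub 1).mul ((hinv.const_mul 2).const_sub 1)
    have hval : w * (w - 0) * ((1 - z) * (1 - z - 0)) / ((1 - 0) * (1 - 2 * 0))
        = w ^ 2 * (1 - z) ^ 2 := by ring
    rw [hval] at hT
    refine hT.congr' ?_
    filter_upwards [Filter.eventually_ge_atTop 4] with n hn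
    have hn' : (4 : ℝ) ≤ n := by exact_mod_cast hn
    have hle : ⌊(n : ℝ) * w⌋₊ ≤ ⌊(n : ℝ) * z⌋₊ :=
      Nat.floor_le_floor (mul_le_mul_of_nonneg_left hwz (by linarith))
    have hle2 : ⌊(n : ℝ) * z⌋₊ ≤ n :=
      Nat.floor_le_of_le (by nlinarith)
    rw [SS_eq hn _ _ hle hle2]
    have h1 : (n : ℝ) - 1 ≠ 0 := by linarith
    have h2 : (n : ℝ) - 2 ≠ 0 := by linarith
    have h0 : (n : ℝ) ≠ 0 := by linarith
    field_simp
  have hsq : ∀ w : ℝ, 0 < w → w < 1 →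
      Filter.Tendsto (fun n : ℕ => √(SS n ⌊(n : ℝ) * w⌋₊ ⌊(n : ℝ) * w⌋₊ / (n : ℝ) ^ 2))
        Filter.atTop (nhds (w * (1 - w))) := by
    intro w hw hw1
    have := (hSlim w w hw le_rfl hw1).sqrt
    rwa [← mul_pow, Real.sqrt_sq (mul_nonneg hw.le (by linarith))] at this
  have hmain := (hSlim u v hu huv hv).div ((hsq u hu hu1).mul (hsq v hv0 hv))
    (mul_ne_zero (mul_ne_zero hu.ne' (by linarith)) (mul_ne_zero hv0.ne' (by linarith)))
  have hval : u ^ 2 * (1 - v) ^ 2 / (u * (1 - u) * (v * (1 - v))) =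
      u * (1 - v) / (v * (1 - u)) := by
    have : 1 - u ≠ 0 := by linarith
    have : 1 - v ≠ 0 := by linarith
    field_simp
  rw [hval] at hmain
  refine hmain.congr' ?_
  filter_upwards [Filter.eventually_ge_atTop 4, hVar] with n hn hV
  have hn' : (4 : ℝ) ≤ n := by exact_mod_cast hn
  have hle : ⌊(n : ℝ) * u⌋₊ ≤ ⌊(n : ℝ) * v⌋₊ :=
    Nat.floor_le_floor (mul_le_mul_of_nonneg_left huv (by linarith))
  have hle2 : ⌊(n : ℝ) * v⌋₊ ≤ n := Nat.floor_le_of_le (by nlinarith)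
  rw [cov_Z hn (G n) _ _ hle hle2 hV.1 hV.2]
  have h0 : (0 : ℝ) < n := by linarith
  simp only [Pi.div_apply]
  rw [Real.sqrt_div' _ (by positivity), Real.sqrt_div' _ (by positivity),
    Real.sqrt_sq h0.le, div_mul_div_comm, ← sq, div_div_div_cancel_right₀ (by positivity)]
end
end
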